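/- A finite digraph D = (V,E) is an interval nest digraph if and only if D is reflexive and there exists a nest ordering on V. -/

import Mathlib

/-- A nest representation of a digraph `E`: closed bounded (nonempty) real intervals
`I_u = [aI u, bI u]` and `J_u = [aJ u, bJ u]` with `J_u ⊆ I_u` for every vertex `u`,
such that `u → v` is an arc iff `I_u ∩ J_v ≠ ∅`. -/
def IsNestRepresentation {V : Type*} (E : V → V → Prop)
    (aI bI aJ bJ : V → ℝ) : Prop :=
  (∀ u, aI u ≤ bI u) ∧ (∀ u, aJ u ≤ bJ u) ∧
  (∀ u, Set.Icc (aJ u) (bJ u) ⊆ Set.Icc (aI u) (bI u)) ∧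
  (∀ u v, E u v ↔ (Set.Icc (aI u) (bI u) ∩ Set.Icc (aJ v) (bJ v)).Nonempty)

/-- An interval nest digraph is one admitting a nest representation. -/
def IsIntervalNestDigraph {V : Type*} (E : V → V → Prop) : Prop :=
  ∃ aI bI aJ bJ : V → ℝ, IsNestRepresentation E aI bI aJ bJ

/-- The arc `uv` is symmetric: both `uv` and `vu` are arcs. -/
def SymArc {V : Type*} (E : V → V → Prop) (u v : V) : Prop := E u v ∧ E v u

/-- A nest ordering of a digraph `E`: a linear order `le` on the vertices such that
for all `u ≤ v ≤ w ≤ z` (repetitions allowed) properties (i), (ii), (iii) hold. -/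
def IsNestOrdering {V : Type*} (E : V → V → Prop) (le : V → V → Prop) : Prop :=
  IsLinearOrder V le ∧
  ∀ u v w z : V, le u v → le v w → le w z →
    ((E u w ∧ E u z → E u v ∨ (SymArc E v w ∧ SymArc E v z ∧ SymArc E w z)) ∧
     (E z u ∧ E z v → E z w ∨ (SymArc E w u ∧ SymArc E v u ∧ SymArc E w v)) ∧
     (E u z ∧ E v w → E u w ∨ E v z) ∧
     (E z u ∧ E w v → E z v ∨ E w u) ∧
     (E u w ∧ E v z → E v w ∨ E u z) ∧
     (E z v ∧ E w u → E z u ∨ E w v))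

section

variable {V : Type*}

/-- Reversing a nest ordering gives a nest ordering. -/
lemma IsNestOrdering.flip {E le : V → V → Prop} (h : IsNestOrdering E le) :
    IsNestOrdering E (fun u v => le v u) := by
  obtain ⟨hlin, h⟩ := h
  refine ⟨{ refl := hlin.refl, trans := fun a b c hab hbc => hlin.trans _ _ _ hbc hab,
            antisymm := fun a b hab hba => hlin.antisymm _ _ hba hab,
            total := fun a b => hlin.total b a }, ?_⟩
  intro u v w z huv hvw hwz
  obtain ⟨h1, h2, h3, h4, h5, h6⟩ := h z w v u hwz hvw huv
  simp only [SymArc] at *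
  grind

/-- The arcs going up in a nest ordering, completed by all pairs going down, form a Ferrers
relation. -/
lemma IsNestOrdering.ferrers {E le : V → V → Prop}
    (h : IsNestOrdering E le) (u v w z : V) (huw : le w u ∨ E u w) (hvz : le z v ∨ E v z) :
    (le z u ∨ E u z) ∨ (le w v ∨ E v w) := by
  by_contra! hcon
  obtain ⟨⟨hzu, nuz⟩, hwv, nvw⟩ := hcon
  obtain ⟨hlin, h⟩ := h
  have huz := (hlin.total u z).resolve_right hzu
  have hvw := (hlin.total v w).resolve_right hwv
  have key : ∀ u v w z, le w u → le v w → le u z → ¬ le z u → ¬ le w v →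
      ¬ E u z → ¬ E v w → le z v ∨ E v z → False := by
    intro u v w z hwu hvw huz hzu hwv nuz nvw hvz
    have e : E v z := by
      rcases hvz with hzv | e
      · exact absurd (hlin.trans _ _ _ hzv (hlin.trans _ _ _ hvw hwu)) hzu
      · exact e
    have h1 := (h v u z z (hlin.trans _ _ _ hvw hwu) huz (hlin.refl z)).1
    have h2 := (h v w u z hvw hwu huz).1
    simp only [SymArc] at h1 h2
    grind
  by_cases hwu : le w u
  · exact key u v w z hwu hvw huz hzu hwv nuz nvw hvz
  by_cases hzv : le z v
  · exact key v u z w hzv huz hvw hwv hzu nvw nuz huw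
  have e1 := huw.resolve_left hwu
  have e2 := hvz.resolve_left hzv
  have huw' := (hlin.total u w).resolve_right hwu
  have hvz' := (hlin.total v z).resolve_right hzv
  rcases hlin.total u v with huv | hvu <;> rcases hlin.total w z with hwz | hzw
  · have := h u v w z huv hvw hwz
    grind
  · have := h u v z w huv hvz' hzw
    grind
  · have := h v u w z hvu huw' hwz
    grind
  · have := h v u z w hvu huz hzw
    grind

/-- If `u → w` goes up, any non-out-neighbour of `w` below `w` precedes any
non-out-neighbour of `u` above `u`. -/
lemma IsNestOrdering.not_le_of_not_arc {E le : V → V → Prop}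
    (h : IsNestOrdering E le) {u w v q : V} (huw : le w u ∨ E u w)
    (huv : le u v) (nuv : ¬ E u v) (hqw : le q w) (nwq : ¬ E w q) (hne : ¬ le v u) :
    ¬ le v q := by
  intro hvq
  obtain ⟨hlin, h⟩ := h
  rcases huw with hwu | e
  · exact hne (hlin.trans _ _ _ hvq (hlin.trans _ _ _ hqw hwu))
  have h1 := (h u q w w (hlin.trans _ _ _ huv hvq) hqw (hlin.refl w)).1
  have h2 := (h u v q w huv hvq hqw).1
  simp only [SymArc] at h1 h2
  tauto

/-- A Ferrers relation `M` containing all pairs that do not go up along `p` has a threshold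
representation `M u w ↔ l w ≤ R u` in which each `R u` lies just below the first point that is
not `M`-related to `u`, and `l w` is as large as possible. -/
lemma exists_threshold [Fintype V] (M : V → V → Prop) (p : V → ℤ) (N : ℤ)
    (hN : ∀ u, p u < N) (hdiag : ∀ u w, p w ≤ p u → M u w)
    (hF : ∀ u v w z, M u w → M v z → M u z ∨ M v w) :
    ∃ R l : V → ℝ, (∀ u w, l w ≤ R u ↔ M u w) ∧ (∀ w, l w ≤ p w) ∧
      (∀ u, ∃ v : ℤ, p u < v ∧ (v : ℝ) - 1 / 2 ≤ R u ∧ (v = N ∨ ∃ w, p w = v ∧ ¬ M u w)) ∧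
      (∀ w x, x ≤ (p w : ℝ) → (∀ u, M u w → x ≤ R u) → x ≤ l w) := by
  classical
  let S : V → Finset ℤ := fun u => insert N ((Finset.univ.filter (fun w => ¬ M u w)).image p)
  have hS : ∀ u, (S u).Nonempty := fun u => Finset.insert_nonempty _ _
  let f : V → ℤ := fun u => (S u).min' (hS u)
  let c : V → Finset V := fun u => Finset.univ.filter (fun w => M u w)
  let ε : ℝ := 1 / (2 * (Fintype.card V + 1))
  let R : V → ℝ := fun u => f u - 1 / 2 + ε * (c u).card
  have hε : 0 < ε := by positivity
  have hc : ∀ u, ε * (c u).card < 1 / 2 := by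
    intro u
    have h1 : ((c u).card : ℝ) ≤ Fintype.card V := by exact_mod_cast Finset.card_le_univ _
    have h2 : ε * (2 * (Fintype.card V + 1)) = 1 := by
      simp only [ε]; field_simp
    nlinarith
  have hc0 : ∀ u, 0 ≤ ε * (c u).card := fun u => by positivity
  have hf_mem : ∀ u, f u = N ∨ ∃ w, p w = f u ∧ ¬ M u w := by
    intro u
    have h1 : f u ∈ S u := Finset.min'_mem _ _
    simp only [S, Finset.mem_insert, Finset.mem_image, Finset.mem_filter, Finset.mem_univ,
      true_and] at h1
    exact h1.imp_right fun ⟨w, hw, e⟩ => ⟨w, e, hw⟩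
  have hf_le : ∀ u w, ¬ M u w → f u ≤ p w := by
    intro u w hw
    refine Finset.min'_le _ _ ?_
    simp only [S, Finset.mem_insert, Finset.mem_image, Finset.mem_filter, Finset.mem_univ,
      true_and]
    exact Or.inr ⟨w, hw, rfl⟩
  have hf_lt : ∀ u, p u < f u := by
    intro u
    rcases hf_mem u with h1 | ⟨w, hw, hM⟩
    · rw [h1]; exact hN u
    · rw [← hw]
      by_contra! hle
      exact hM (hdiag u w hle)
  have hfN : ∀ u, f u ≤ N := fun u => Finset.min'_le _ _ (Finset.mem_insert_self _ _)
  have hRlt : ∀ u v w, ¬ M u w → M v w → R u < R v := by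
    intro u v w hu hv
    have hsub : ∀ x, M u x → M v x := fun x hx => (hF u v x w hx hv).resolve_left hu
    have h1 : f u ≤ f v := by
      rcases hf_mem v with h1 | ⟨x, hx, hM⟩
      · rw [h1]; exact hfN u
      · rw [← hx]
        exact hf_le u x fun h2 => hM (hsub x h2)
    have h2 : (c u).card < (c v).card := by
      refine Finset.card_lt_card ((Finset.ssubset_iff_of_subset ?_).2 ⟨w, ?_, ?_⟩)
      · intro x
        simpa [c] using hsub x
      · simpa [c] using hv
      · simpa [c] using hu
    have h1' : (f u : ℝ) ≤ f v := by exact_mod_cast h1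
    have h2' : ((c u).card : ℝ) < (c v).card := by exact_mod_cast h2
    have := mul_lt_mul_of_pos_left h2' hε
    simp only [R]
    linarith
  let T : V → Finset ℝ := fun w =>
    insert (p w : ℝ) ((Finset.univ.filter (fun u => M u w)).image R)
  have hT : ∀ w, (T w).Nonempty := fun w => Finset.insert_nonempty _ _
  have hTmem : ∀ w y, y ∈ T w ↔ y = p w ∨ ∃ u, M u w ∧ R u = y := by
    intro w y
    simp [T]
  refine ⟨R, fun w => (T w).min' (hT w), ?_, ?_, ?_, ?_⟩
  · intro u w
    constructor
    · intro hle
      by_contra hM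
      have h1 := (hTmem w _).1 (Finset.min'_mem (T w) (hT w))
      rcases h1 with h1 | ⟨v, hv, h1⟩
      · have h2 : (f u : ℝ) ≤ p w := by exact_mod_cast hf_le u w hM
        have h3 := hc u
        simp only [R] at hle
        linarith
      · have := hRlt u v w hM hv
        linarith
    · intro hM
      exact Finset.min'_le _ _ ((hTmem w _).2 (Or.inr ⟨u, hM, rfl⟩))
  · intro w
    exact Finset.min'_le _ _ ((hTmem w _).2 (Or.inl rfl))
  · intro u
    refine ⟨f u, hf_lt u, ?_, hf_mem u⟩
    have := hc0 u
    simp only [R]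
    linarith
  · intro w x hx hall
    refine Finset.le_min' _ _ _ fun y hy => ?_
    rcases (hTmem w y).1 hy with rfl | ⟨u, hu, rfl⟩
    · exact hx
    · exact hall u hu

lemma nonempty_Icc_inter_Icc_iff {a b c d : ℝ} (hab : a ≤ b) (hcd : c ≤ d) :
    (Set.Icc a b ∩ Set.Icc c d).Nonempty ↔ c ≤ b ∧ a ≤ d := by
  rw [Set.Icc_inter_Icc, Set.nonempty_Icc, sup_le_iff, le_inf_iff, le_inf_iff]
  tauto

/-- Every finite linear order is given by an integer-valued ranking. -/
lemma exists_rank [Fintype V] (le : V → V → Prop) (h : IsLinearOrder V le) :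
    ∃ p : V → ℤ, ∀ u v, p u ≤ p v ↔ le u v := by
  classical
  have hmono : ∀ u v, le u v → (Finset.univ.filter (fun x => le x u)).card ≤
      (Finset.univ.filter (fun x => le x v)).card := by
    intro u v huv
    refine Finset.card_le_card fun x => ?_
    simpa using fun hx => h.trans _ _ _ hx huv
  refine ⟨fun u => ((Finset.univ.filter (fun x => le x u)).card : ℤ), fun u v => ?_⟩
  rw [Nat.cast_le]
  refine ⟨fun hle => ?_, hmono u v⟩
  by_contra hn
  have hvu := (h.total u v).resolve_left hn
  refine absurd hle (not_le.2 (Finset.card_lt_card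
    ((Finset.ssubset_iff_of_subset ?_).2 ⟨u, ?_, ?_⟩)))
  · intro x
    simpa using fun hx => h.trans _ _ _ hx hvu
  · simpa using h.refl u
  · simpa using hn

/-- A finite reflexive digraph with a nest ordering has a nest representation. -/
lemma IsNestOrdering.isIntervalNestDigraph [Fintype V] {E le : V → V → Prop}
    (hr : ∀ u, E u u) (h : IsNestOrdering E le) : IsIntervalNestDigraph E := by
  obtain ⟨p, hp⟩ := exists_rank le h.1
  obtain ⟨N, hN⟩ : ∃ N : ℤ, ∀ u, p u < N := by
    obtain ⟨B, hB⟩ := (Set.finite_range p).bddAbove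
    exact ⟨B + 1, fun u => Int.lt_add_one_of_le (hB ⟨u, rfl⟩)⟩
  obtain ⟨N', hN'⟩ : ∃ N : ℤ, ∀ u, - p u < N := by
    obtain ⟨B, hB⟩ := (Set.finite_range fun u => - p u).bddAbove
    exact ⟨B + 1, fun u => Int.lt_add_one_of_le (hB ⟨u, rfl⟩)⟩
  obtain ⟨R, l, hRl, hlp, hR, hl⟩ := exists_threshold (fun u w => le w u ∨ E u w) p N hN
    (fun u w huw => Or.inl ((hp _ _).1 huw)) (fun u v w z => h.ferrers u v w z)
  obtain ⟨L, r, hLr, hrp, hL, hr'⟩ := exists_threshold (fun u w => le u w ∨ E u w)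
    (fun u => - p u) N' hN' (fun u w huw => Or.inl ((hp _ _).1 (by simpa using huw)))
    (fun u v w z => h.flip.ferrers u v w z)
  have hpR : ∀ u, (p u : ℝ) ≤ R u := by
    intro u
    obtain ⟨v, hv, hvR, -⟩ := hR u
    have : (p u : ℝ) + 1 ≤ v := by exact_mod_cast hv
    linarith
  have hpL : ∀ u, - (p u : ℝ) ≤ L u := by
    intro u
    obtain ⟨v, hv, hvR, -⟩ := hL u
    have : - (p u : ℝ) + 1 ≤ v := by exact_mod_cast hv
    linarith
  have hrp' : ∀ u, r u ≤ - (p u : ℝ) := fun u => by simpa using hrp u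
  have hLR : ∀ u w, (le w u ∨ E u w) ∨ (le w u ∨ E w u) → - L w ≤ R u := by
    intro u w huw
    obtain ⟨v, hv, hvR, hv'⟩ := hR u
    obtain ⟨q, hq, hqL, hq'⟩ := hL w
    suffices hlt : - q < v by
      have : - (q : ℝ) + 1 ≤ v := by exact_mod_cast hlt
      linarith
    rcases hv' with rfl | ⟨x, rfl, hx⟩
    · have := hN w
      omega
    rcases hq' with rfl | ⟨y, rfl, hy⟩
    · have := hN' x
      omega
    push Not at hx hy
    have hux := (hp u x).1 hv.le
    have hyw : le y w := (hp y w).1 (by omega)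
    simp only [neg_neg]
    by_contra! hle
    rcases huw with huw | huw
    · exact h.not_le_of_not_arc huw hux hx.2 hyw hy.2 hx.1 ((hp _ _).1 hle)
    · exact h.flip.not_le_of_not_arc huw hyw hy.2 hux hx.2 hy.1
        ((hp _ _).1 hle)
  have hLl : ∀ u, - L u ≤ l u := fun u =>
    hl u _ (by linarith [hpL u]) fun v hv => hLR v u (Or.inl hv)
  have hrR : ∀ u, - R u ≤ r u := fun u =>
    hr' u _ (by push_cast; linarith [hpR u]) fun v hv => by
      linarith [hLR u v (Or.inr hv)]
  have hlr : ∀ u, l u ≤ - r u := fun u => (hlp u).trans (by linarith [hrp' u])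
  have hLR' : ∀ u, - L u ≤ R u := fun u => by linarith [hpL u, hpR u]
  refine ⟨fun u => - L u, R, l, fun u => - r u, hLR', hlr, fun u =>
    Set.Icc_subset_Icc (hLl u) (by linarith [hrR u]), fun u v => ?_⟩
  rw [nonempty_Icc_inter_Icc_iff (hLR' u) (hlr v), hRl, neg_le_neg_iff, hLr]
  constructor
  · exact fun e => ⟨Or.inr e, Or.inr e⟩
  · rintro ⟨h1 | e, h2 | e'⟩
    · rw [h.1.antisymm _ _ h1 h2]
      exact hr u
    all_goals assumption

/-- Some linear order makes a given real-valued function on a type monotone. -/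
lemma exists_isLinearOrder_monotone (f : V → ℝ) :
    ∃ le : V → V → Prop, IsLinearOrder V le ∧ ∀ u v, le u v → f u ≤ f v := by
  classical
  let _ : LinearOrder V := linearOrderOfSTO WellOrderingRel
  let g : V → ℝ ×ₗ V := fun u => toLex (f u, u)
  have hg : Function.Injective g := fun u v huv => congrArg (fun x => (ofLex x).2) huv
  refine ⟨fun u v => g u ≤ g v,
    { refl := fun a => le_rfl
      trans := fun a b c => le_trans
      antisymm := fun a b h1 h2 => hg (le_antisymm h1 h2)
      total := fun a b => le_total _ _ }, ?_⟩
  intro u v huv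
  rcases (Prod.Lex.le_iff).1 huv with h | h
  · exact h.le
  · exact h.1.le

/-- Ordering the vertices by the right endpoints of the inner intervals of a nest representation
gives a nest ordering. -/
lemma IsIntervalNestDigraph.exists_isNestOrdering {E : V → V → Prop} (h : IsIntervalNestDigraph E) :
    (∀ u, E u u) ∧ ∃ le : V → V → Prop, IsNestOrdering E le := by
  obtain ⟨aI, bI, aJ, bJ, hI, hJ, hsub, hE⟩ := h
  have hE' : ∀ u v, E u v ↔ aJ v ≤ bI u ∧ aI u ≤ bJ v := fun u v => by
    rw [hE, nonempty_Icc_inter_Icc_iff (hI u) (hJ v)]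
  have hs : ∀ u, aI u ≤ aJ u ∧ bJ u ≤ bI u := fun u => (Set.Icc_subset_Icc_iff (hJ u)).1 (hsub u)
  refine ⟨fun u => (hE' u u).2 ⟨(hJ u).trans (hs u).2, (hs u).1.trans (hJ u)⟩, ?_⟩
  obtain ⟨le, hlin, hle⟩ := exists_isLinearOrder_monotone bJ
  refine ⟨le, hlin, fun u v w z huv hvw hwz => ?_⟩
  replace huv := hle _ _ huv
  replace hvw := hle _ _ hvw
  replace hwz := hle _ _ hwz
  have := hs u
  have := hs v
  have := hs w
  have := hs z
  have := hJ u
  have := hJ v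
  have := hJ w
  have := hJ z
  simp only [SymArc, hE']
  refine ⟨?_, ?_, ?_, ?_, ?_, ?_⟩ <;> grind

end

/-- A finite digraph `D = (V,E)` is an interval nest digraph if and only if `D` is
reflexive and there exists a nest ordering on `V`. -/
theorem interval_nest_iff_reflexive_and_nest_ordering
    {V : Type*} [Fintype V] (E : V → V → Prop) :
    IsIntervalNestDigraph E ↔
      ((∀ u, E u u) ∧ ∃ le : V → V → Prop, IsNestOrdering E le) :=
  ⟨IsIntervalNestDigraph.exists_isNestOrdering,
    fun ⟨hr, _, h⟩ => h.isIntervalNestDigraph hr⟩
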